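/- Let ν > 0, η > 0 and γ > 0, and let g : ℝ → ℝ be a smooth 2π-periodic function, not identically zero, having finitely many zeroes in [0, 2π), all of them simple (g(x) = 0 implies g'(x) ≠ 0). Then for every β ∈ [0, γ/4] there exist constants c > 0 and C > 0 such that for every ε ∈ (0,1], every twice continuously differentiable 2π-periodic function v : ℝ → ℝ satisfying ν v''(x) + η v(x) − v(x)³ + ε^{-γ} g(x) = 0 for all x, and every 2π-periodic measurable function u : ℝ → ℝ with ∫₀^{2π} u(x)⁴ dx < ∞, one has ∫₀^{2π} (u(x) − v(x)) (u(x)³ − v(x)³) dx ≥ c ε^{-2β} ∫₀^{2π} (u(x) − v(x))² dx − C ε^{(γ−13β)/3}. -/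

import Mathlib

open MeasureTheory

theorem aux_nodip {v v1 v2 : ℝ → ℝ} (h1 : ∀ x, HasDerivAt v (v1 x) x)
    (h2 : ∀ x, HasDerivAt v1 (v2 x) x) {M x y z : ℝ} (hxy : x < y) (hyz : y < z)
    (hx : M ≤ v x) (hz : M ≤ v z) (hneg : ∀ t ∈ Set.Icc x z, v t < M → v2 t < 0) :
    M ≤ v y := by
  by_contra! hy
  have hc : Continuous v := continuous_iff_continuousAt.2 fun t => (h1 t).continuousAt
  obtain ⟨m, hm, hmin⟩ := isCompact_Icc.exists_isMinOn (Set.nonempty_Icc.2 (hxy.trans hyz).le)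
    hc.continuousOn (f := v) (s := Set.Icc x z)
  have hmy : v m < M := lt_of_le_of_lt (hmin ⟨hxy.le, hyz.le⟩) hy
  have hmx : x < m := lt_of_le_of_ne hm.1 (by rintro rfl; linarith)
  have hmz : m < z := lt_of_le_of_ne hm.2 (by rintro rfl; linarith)
  have hloc : IsLocalMin v m := hmin.isLocalMin (Icc_mem_nhds hmx hmz)
  have hd1 : deriv v = v1 := funext fun t => (h1 t).deriv
  have hd2 : deriv v1 = v2 := funext fun t => (h2 t).deriv
  have hlt := hneg m hm hmy
  have hmax : IsLocalMax v m := isLocalMax_of_deriv_deriv_neg (by rw [hd1, hd2]; exact hlt)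
    hloc.deriv_eq_zero hc.continuousAt
  have hconst : v =ᶠ[nhds m] fun _ => v m := by
    filter_upwards [hloc, hmax] with t a b using le_antisymm b a
  have := hconst.deriv.deriv_eq
  rw [hd1, hd2] at this
  simp at this
  linarith

theorem aux_mid {v v1 v2 : ℝ → ℝ} (h1 : ∀ x, HasDerivAt v (v1 x) x)
    (h2 : ∀ x, HasDerivAt v1 (v2 x) x) {K x z : ℝ} (hxz : x < z)
    (hneg : ∀ t ∈ Set.Icc x z, v2 t ≤ -K) :
    (v x + v z) / 2 + K * (z - x) ^ 2 / 8 ≤ v ((x + z) / 2) := by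
  have w1 : ∀ t, HasDerivAt (fun t => v t + K * t ^ 2 / 2) (v1 t + K * t) t := fun t => by
    have := (h1 t).add ((((hasDerivAt_id' t).pow 2).const_mul K).div_const 2)
    exact this.congr_deriv (by norm_num; ring)
  have w2 : ∀ t, HasDerivAt (fun t => v1 t + K * t) (v2 t + K) t := fun t => by
    have := (h2 t).add ((hasDerivAt_id' t).const_mul K)
    exact this.congr_deriv (by simp)
  have hconc : ConcaveOn ℝ (Set.Icc x z) (fun t => v t + K * t ^ 2 / 2) := by
    refine concaveOn_of_hasDerivWithinAt2_nonpos (convex_Icc x z)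
      (fun t _ => (w1 t).continuousAt.continuousWithinAt)
      (fun t _ => (w1 t).hasDerivWithinAt) (fun t _ => (w2 t).hasDerivWithinAt) ?_
    intro t ht
    have := hneg t (interior_subset ht)
    linarith
  have := hconc.2 (Set.left_mem_Icc.2 hxz.le) (Set.right_mem_Icc.2 hxz.le)
    (by norm_num : (0:ℝ) ≤ 1 / 2) (by norm_num : (0:ℝ) ≤ 1 / 2) (by norm_num)
  simp only [smul_eq_mul] at this
  rw [show (1 / 2 * x + 1 / 2 * z) = (x + z) / 2 by ring] at this
  nlinarith

theorem aux_vol {S : Set ℝ} {D : ℝ} (h : ∀ x ∈ S, ∀ z ∈ S, x < z → z - x ≤ D) (hD : 0 ≤ D) :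
    volume S ≤ ENNReal.ofReal D := by
  refine (Real.volume_le_diam S).trans (Metric.ediam_le fun x hx z hz => ?_)
  rw [edist_dist]
  refine ENNReal.ofReal_le_ofReal ?_
  rw [Real.dist_eq]
  rcases lt_trichotomy x z with hh | hh | hh
  · rw [abs_sub_comm, abs_of_pos (by linarith)]; exact h x hx z hz hh
  · simp [hh, hD]
  · rw [abs_of_pos (by linarith)]; exact h z hz x hx hh

theorem aux_core {v v1 v2 : ℝ → ℝ} (h1 : ∀ x, HasDerivAt v (v1 x) x)
    (h2 : ∀ x, HasDerivAt v1 (v2 x) x) {K M D : ℝ} (hK : 0 < K) (hD : 0 ≤ D)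
    (hKD : 16 * M ≤ K * D ^ 2) {I : Set ℝ} (hI : I.OrdConnected)
    (hneg : ∀ t ∈ I, v t < M → v2 t ≤ -K) :
    volume (I ∩ {x | |v x| < M}) ≤ ENNReal.ofReal (2 * D) := by
  have key : ∀ x ∈ I ∩ {x | |v x| < M}, ∀ z ∈ I ∩ {x | |v x| < M}, x < z →
      (∀ t ∈ Set.Icc x z, v t < M) → z - x ≤ D := by
    rintro x ⟨hxI, hx⟩ z ⟨hzI, hz⟩ hxz hlt
    have hmid := aux_mid h1 h2 hxz (K := K) fun t ht => hneg t (hI.out hxI hzI ht) (hlt t ht)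
    have hm := hlt ((x + z) / 2) ⟨by linarith, by linarith⟩
    rw [Set.mem_ofPred_eq] at hx hz
    have a := (abs_lt.1 hx).1
    have b := (abs_lt.1 hz).1
    have : K * (z - x) ^ 2 ≤ K * D ^ 2 := by linarith
    have := le_of_mul_le_mul_left this hK
    exact abs_le_of_sq_le_sq' this hD |>.2
  by_cases hy : ∃ y ∈ I, M ≤ v y
  · obtain ⟨y, hyI, hy⟩ := hy
    have hsub : I ∩ {x | |v x| < M} ⊆ ((I ∩ {x | |v x| < M}) ∩ Set.Iio y) ∪
        ((I ∩ {x | |v x| < M}) ∩ Set.Ioi y) := by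
      intro x hx
      rcases lt_trichotomy x y with h | h | h
      · exact Or.inl ⟨hx, h⟩
      · subst h
        have := (abs_lt.1 (by simpa using hx.2 : |v x| < M)).2
        linarith
      · exact Or.inr ⟨hx, h⟩
    refine (measure_mono hsub).trans ((measure_union_le _ _).trans ?_)
    rw [two_mul, ENNReal.ofReal_add hD hD]
    refine add_le_add (aux_vol ?_ hD) (aux_vol ?_ hD)
    · rintro x ⟨hx, hxy⟩ z ⟨hz, hzy⟩ hxz
      refine key x hx z hz hxz fun t ht => ?_
      by_contra! htM
      have hzM := (abs_lt.1 (by simpa using hz.2 : |v z| < M)).2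
      have htz : t < z := lt_of_le_of_ne ht.2 (by rintro rfl; linarith)
      have := aux_nodip h1 h2 htz hzy htM hy fun s hs hsM => by
        have := hneg s (hI.out hx.1 hyI ⟨ht.1.trans hs.1, hs.2⟩) hsM
        linarith
      linarith
    · rintro x ⟨hx, hxy⟩ z ⟨hz, hzy⟩ hxz
      refine key x hx z hz hxz fun t ht => ?_
      by_contra! htM
      have hxM := (abs_lt.1 (by simpa using hx.2 : |v x| < M)).2
      have htz : x < t := lt_of_le_of_ne ht.1 (by rintro rfl; linarith)
      have := aux_nodip h1 h2 hxy htz hy htM fun s hs hsM => by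
        have := hneg s (hI.out hyI hz.1 ⟨hs.1, hs.2.trans ht.2⟩) hsM
        linarith
      linarith
  · push Not at hy
    refine (aux_vol (D := D) ?_ hD).trans (ENNReal.ofReal_le_ofReal (by linarith))
    intro x hx z hz hxz
    exact key x hx z hz hxz fun t ht => hy t (hI.out hx.1 hz.1 ht)

theorem aux_pde_pos {v v1 v2 G : ℝ → ℝ} (h1 : ∀ x, HasDerivAt v (v1 x) x)
    (h2 : ∀ x, HasDerivAt v1 (v2 x) x) {ν η M P D : ℝ} (hν : 0 < ν) (hη : 0 < η)
    (hM : 1 ≤ M) (hP : 2 * (1 + η) ^ 2 * M ^ 3 ≤ P) (hD : 0 ≤ D)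
    (hPD : 32 * ν * M ≤ P * D ^ 2)
    (hv : ∀ x, ν * v2 x + η * v x - v x ^ 3 + G x = 0) {I : Set ℝ} (hI : I.OrdConnected)
    (hG : ∀ x ∈ I, P ≤ G x) :
    volume (I ∩ {x | |v x| < M}) ≤ ENNReal.ofReal (2 * D) := by
  have hM3 : 1 ≤ M ^ 3 := one_le_pow₀ hM
  have hP0 : 0 < P := lt_of_lt_of_le (by positivity) hP
  refine aux_core h1 h2 (K := P / (2 * ν)) (by positivity) hD ?_ hI ?_
  · rw [div_mul_eq_mul_div, le_div_iff₀ (by positivity)]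
    linarith
  · intro t ht hvt
    have hb : v t ^ 3 - η * v t ≤ (1 + η) ^ 2 * M ^ 3 := by
      have h0 : M ^ 3 ≤ (1 + η) ^ 2 * M ^ 3 := by
        have : 1 ≤ (1 + η) ^ 2 := by nlinarith
        nlinarith
      have h0' : (1 + η) ^ 2 ≤ (1 + η) ^ 2 * M ^ 3 := by nlinarith [sq_nonneg (1 + η)]
      rcases le_total 0 (v t) with h | h
      · have : v t ^ 3 ≤ M ^ 3 := pow_le_pow_left₀ h hvt.le 3
        have := mul_nonneg hη.le h
        linarith
      · refine le_trans ?_ h0'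
        set s := -v t with hs
        have hs0 : 0 ≤ s := by linarith
        have : v t = -s := by linarith
        rw [this]
        rcases le_total s (1 + η) with h3 | h3
        · have : 0 ≤ s ^ 3 := by positivity
          nlinarith
        · have : η * s ≤ s ^ 3 := by nlinarith [mul_nonneg hs0 (sub_nonneg.2 h3), mul_nonneg hs0 (mul_nonneg hs0 (sub_nonneg.2 h3))]
          nlinarith [sq_nonneg (1 + η)]
    have := hv t
    have := hG t ht
    rw [← neg_div, le_div_iff₀ (by positivity)]
    nlinarith

theorem aux_pde {v v1 v2 G : ℝ → ℝ} (h1 : ∀ x, HasDerivAt v (v1 x) x)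
    (h2 : ∀ x, HasDerivAt v1 (v2 x) x) {ν η M P D : ℝ} (hν : 0 < ν) (hη : 0 < η)
    (hM : 1 ≤ M) (hP : 2 * (1 + η) ^ 2 * M ^ 3 ≤ P) (hD : 0 ≤ D)
    (hPD : 32 * ν * M ≤ P * D ^ 2)
    (hv : ∀ x, ν * v2 x + η * v x - v x ^ 3 + G x = 0) {I : Set ℝ} (hI : I.OrdConnected)
    (hG : (∀ x ∈ I, P ≤ G x) ∨ (∀ x ∈ I, P ≤ -G x)) :
    volume (I ∩ {x | |v x| < M}) ≤ ENNReal.ofReal (2 * D) := by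
  rcases hG with hG | hG
  · exact aux_pde_pos h1 h2 hν hη hM hP hD hPD hv hI hG
  · have := aux_pde_pos (v := fun x => -v x) (G := fun x => -G x) (fun x => (h1 x).neg)
      (fun x => (h2 x).neg) hν hη hM hP hD hPD (fun x => by linarith [hv x]) hI hG
    simpa only [abs_neg] using this

theorem aux_eps {v v1 v2 g : ℝ → ℝ} (h1 : ∀ x, HasDerivAt v (v1 x) x)
    (h2 : ∀ x, HasDerivAt v1 (v2 x) x) {ν η γ β ε : ℝ} (hν : 0 < ν) (hη : 0 < η)
    (hβ : β ∈ Set.Icc 0 (γ / 4)) (hε : ε ∈ Set.Ioc (0:ℝ) 1)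
    (hv : ∀ x, ν * v2 x + η * v x - v x ^ 3 + ε ^ (-γ) * g x = 0) {I : Set ℝ}
    (hI : I.OrdConnected)
    (hG : (∀ x ∈ I, 2 * (1 + η) ^ 2 * ε ^ ((γ - β) / 3) ≤ g x) ∨
      (∀ x ∈ I, 2 * (1 + η) ^ 2 * ε ^ ((γ - β) / 3) ≤ -g x)) :
    volume (I ∩ {x | |v x| < ε ^ (-β)}) ≤
      ENNReal.ofReal (2 * (1 + 16 * ν) * ε ^ ((γ - β) / 3)) := by
  obtain ⟨hε0, hε1⟩ := hε
  obtain ⟨hβ0, hβ1⟩ := hβ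
  have hg0 : 0 < ε ^ (-γ) := Real.rpow_pos_of_pos hε0 _
  have hd0 : 0 < ε ^ ((γ - β) / 3) := Real.rpow_pos_of_pos hε0 _
  have hM0 : 0 < ε ^ (-β) := Real.rpow_pos_of_pos hε0 _
  rw [mul_assoc 2]
  have e1 : (ε ^ (-β)) ^ 3 ≤ ε ^ (-γ) * ε ^ ((γ - β) / 3) := by
    rw [← Real.rpow_natCast, ← Real.rpow_mul hε0.le, ← Real.rpow_add hε0]
    apply Real.rpow_le_rpow_of_exponent_ge hε0 hε1
    push_cast
    linarith
  have e2 : ε ^ (-β) = ε ^ (-γ) * (ε ^ ((γ - β) / 3)) ^ 3 := by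
    rw [← Real.rpow_natCast, ← Real.rpow_mul hε0.le, ← Real.rpow_add hε0]
    congr 1
    push_cast
    ring
  refine aux_pde h1 h2 hν hη (P := ε ^ (-γ) * (2 * (1 + η) ^ 2 * ε ^ ((γ - β) / 3)))
    (G := fun x => ε ^ (-γ) * g x) ?_ ?_ (by positivity) ?_ hv hI ?_
  · exact Real.one_le_rpow_of_pos_of_le_one_of_nonpos hε0 hε1 (by linarith)
  · have : 0 < 2 * (1 + η) ^ 2 := by positivity
    nlinarith
  · have : ε ^ (-γ) * (2 * (1 + η) ^ 2 * ε ^ ((γ - β) / 3)) *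
        ((1 + 16 * ν) * ε ^ ((γ - β) / 3)) ^ 2 = 2 * (1 + η) ^ 2 * (1 + 16 * ν) ^ 2 * ε ^ (-β) := by
      rw [e2]; ring
    rw [this]
    refine mul_le_mul_of_nonneg_right ?_ hM0.le
    have : 1 ≤ (1 + η) ^ 2 := by nlinarith
    nlinarith [sq_nonneg (1 + 16 * ν)]
  · refine hG.imp (fun h x hx => ?_) (fun h x hx => ?_)
    · exact mul_le_mul_of_nonneg_left (h x hx) hg0.le
    · rw [← mul_neg]; exact mul_le_mul_of_nonneg_left (h x hx) hg0.le

/-- Families of (scale, bad set). -/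
def AuxFam (g : ℝ → ℝ) (L B : ℝ) (F : Set (ℝ × Set ℝ)) : Prop :=
  ∀ p ∈ F, 0 < p.1 ∧ ∀ I : Set ℝ, I.OrdConnected →
    ((∀ x ∈ I, L * p.1 ≤ g x) ∨ (∀ x ∈ I, L * p.1 ≤ -g x)) →
    volume (I ∩ p.2) ≤ ENNReal.ofReal (B * p.1)

theorem AuxFam.neg {g : ℝ → ℝ} {L B : ℝ} {F : Set (ℝ × Set ℝ)} (h : AuxFam g L B F) :
    AuxFam (fun x => -g x) L B F := fun p hp =>
  ⟨(h p hp).1, fun I hI hg => (h p hp).2 I hI (by simpa [or_comm] using hg)⟩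

theorem aux_local_pos {g : ℝ → ℝ} {L B : ℝ} (hL : 0 < L) (hB : 0 < B) {F : Set (ℝ × Set ℝ)}
    (h : AuxFam g L B F) {x0 : ℝ} (hg : ContinuousAt g x0) (h0 : 0 < g x0) :
    ∃ t ∈ nhds x0, ∃ C : ℝ, 0 ≤ C ∧ ∀ p ∈ F, volume (t ∩ p.2) ≤ ENNReal.ofReal (C * p.1) := by
  have := hg.eventually (lt_mem_nhds (half_lt_self h0))
  obtain ⟨r, hr, hball⟩ := Metric.eventually_nhds_iff_ball.1 this
  refine ⟨Metric.ball x0 r, Metric.ball_mem_nhds _ hr, B + 2 * r * (2 * L / g x0), by positivity, ?_⟩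
  intro p hp
  obtain ⟨hp0, hpI⟩ := h p hp
  have hfrac : 0 < 2 * L / g x0 := by positivity
  by_cases hc : L * p.1 ≤ g x0 / 2
  · refine (hpI _ ?_ (Or.inl fun x hx => hc.trans (hball x hx).le)).trans
      (ENNReal.ofReal_le_ofReal ?_)
    · rw [Real.ball_eq_Ioo]; exact Set.ordConnected_Ioo
    · have : 0 ≤ 2 * r * (2 * L / g x0) * p.1 := by positivity
      linarith
  · push Not at hc
    refine (measure_mono Set.inter_subset_left).trans ?_
    rw [Real.volume_ball]
    refine ENNReal.ofReal_le_ofReal ?_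
    have : 1 ≤ 2 * L / g x0 * p.1 := by
      rw [div_mul_eq_mul_div, le_div_iff₀ h0]; linarith
    have : 0 ≤ B * p.1 := by positivity
    nlinarith

theorem aux_local_simple {g : ℝ → ℝ} {L B : ℝ} (hL : 0 < L) (hB : 0 < B) {F : Set (ℝ × Set ℝ)}
    (h : AuxFam g L B F) {x0 d : ℝ} (hg : HasDerivAt g d x0) (h0 : g x0 = 0) (hd : 0 < d) :
    ∃ t ∈ nhds x0, ∃ C : ℝ, 0 ≤ C ∧ ∀ p ∈ F, volume (t ∩ p.2) ≤ ENNReal.ofReal (C * p.1) := by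
  have := (hasDerivAt_iff_isLittleO.1 hg).def (half_pos hd)
  obtain ⟨r, hr, hball⟩ := Metric.eventually_nhds_iff_ball.1 this
  simp only [h0, Real.norm_eq_abs, smul_eq_mul, sub_zero] at hball
  rw [Real.ball_eq_Ioo] at hball
  refine ⟨Set.Ioo (x0 - r) (x0 + r), Ioo_mem_nhds (by linarith) (by linarith),
    B + 4 * L / d + B, by positivity, ?_⟩
  intro p hp
  obtain ⟨hp0, hpI⟩ := h p hp
  set q := 2 * L / d * p.1 with hq
  have hq0 : 0 < q := by positivity
  have hqd : d / 2 * q = L * p.1 := by rw [hq]; field_simp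
  have hsub : Set.Ioo (x0 - r) (x0 + r) ∩ p.2 ⊆ ((Set.Ioo (x0 - r) (x0 + r) ∩ Set.Iic (x0 - q)) ∩ p.2) ∪
      Set.Icc (x0 - q) (x0 + q) ∪ ((Set.Ioo (x0 - r) (x0 + r) ∩ Set.Ici (x0 + q)) ∩ p.2) := by
    rintro x ⟨hx, hxp⟩
    rcases le_total x (x0 - q) with a | a
    · exact Or.inl (Or.inl ⟨⟨hx, a⟩, hxp⟩)
    · rcases le_total x (x0 + q) with b | b
      · exact Or.inl (Or.inr ⟨a, b⟩)
      · exact Or.inr ⟨⟨hx, b⟩, hxp⟩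
  refine (measure_mono hsub).trans ((measure_union_le _ _).trans ?_)
  rw [add_mul, ENNReal.ofReal_add (by positivity) (by positivity)]
  refine add_le_add ((measure_union_le _ _).trans ?_) (hpI _ ?_ (Or.inl ?_))
  · rw [add_mul, ENNReal.ofReal_add (by positivity) (by positivity)]
    refine add_le_add (hpI _ ?_ (Or.inr ?_)) ?_
    · exact Set.ordConnected_Ioo.inter Set.ordConnected_Iic
    · rintro x ⟨hx, hxq⟩
      have hxq : x ≤ x0 - q := hxq
      have := hball x hx
      rw [abs_of_nonpos (by linarith : x - x0 ≤ 0)] at this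
      have := (abs_le.1 this).2
      nlinarith
    · rw [Real.volume_Icc]
      refine ENNReal.ofReal_le_ofReal (le_of_eq ?_)
      rw [hq]; ring
  · exact Set.ordConnected_Ioo.inter Set.ordConnected_Ici
  · rintro x ⟨hx, hxq⟩
    have hxq : x0 + q ≤ x := hxq
    have := hball x hx
    rw [abs_of_nonneg (by linarith : 0 ≤ x - x0)] at this
    have := (abs_le.1 this).1
    nlinarith

theorem aux_global {g : ℝ → ℝ} {L B : ℝ} (hL : 0 < L) (hB : 0 < B) {F : Set (ℝ × Set ℝ)}
    (h : AuxFam g L B F) (hg : Differentiable ℝ g) (hs : ∀ x, g x = 0 → deriv g x ≠ 0)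
    {S : Set ℝ} (hS : IsCompact S) :
    ∃ C : ℝ, 0 ≤ C ∧ ∀ p ∈ F, volume (S ∩ p.2) ≤ ENNReal.ofReal (C * p.1) := by
  refine hS.induction_on (p := fun S => ∃ C : ℝ, 0 ≤ C ∧ ∀ p ∈ F,
    volume (S ∩ p.2) ≤ ENNReal.ofReal (C * p.1)) ?_ ?_ ?_ ?_
  · exact ⟨0, le_rfl, by simp⟩
  · rintro s t hst ⟨C, hC, H⟩
    exact ⟨C, hC, fun p hp => (measure_mono (Set.inter_subset_inter_left _ hst)).trans (H p hp)⟩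
  · rintro s t ⟨C, hC, H⟩ ⟨C', hC', H'⟩
    refine ⟨C + C', by positivity, fun p hp => ?_⟩
    have := (h p hp).1
    rw [Set.union_inter_distrib_right, add_mul, ENNReal.ofReal_add (by positivity) (by positivity)]
    exact (measure_union_le _ _).trans (add_le_add (H p hp) (H' p hp))
  · intro x _
    suffices ∃ t ∈ nhds x, ∃ C : ℝ, 0 ≤ C ∧ ∀ p ∈ F,
        volume (t ∩ p.2) ≤ ENNReal.ofReal (C * p.1) by
      obtain ⟨t, ht, H⟩ := this
      exact ⟨t, mem_nhdsWithin_of_mem_nhds ht, H⟩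
    rcases lt_trichotomy (g x) 0 with h0 | h0 | h0
    · exact aux_local_pos hL hB h.neg (hg x).continuousAt.neg (by linarith)
    · rcases lt_or_gt_of_ne (hs x h0) with hd | hd
      · exact aux_local_simple hL hB h.neg (hg x).hasDerivAt.neg (by simp [h0]) (by linarith)
      · exact aux_local_simple hL hB h (hg x).hasDerivAt h0 hd
    · exact aux_local_pos hL hB h (hg x).continuousAt h0

theorem aux_pointwise (a b M : ℝ) (hM : 0 ≤ M) :
    1 / 2 * M ^ 2 * (a - b) ^ 2 - (if |b| < M then M ^ 4 / 4 else 0) ≤ (a - b) * (a ^ 3 - b ^ 3) := by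
  have e : (a - b) * (a ^ 3 - b ^ 3) = (a - b) ^ 2 * (a ^ 2 + a * b + b ^ 2) := by ring
  rw [e]
  have hw := sq_nonneg (a - b)
  split_ifs with h
  · have : (a - b) ^ 2 * ((a - b) ^ 2 / 4) ≤ (a - b) ^ 2 * (a ^ 2 + a * b + b ^ 2) :=
      mul_le_mul_of_nonneg_left (by nlinarith [sq_nonneg (a + b)]) hw
    nlinarith [sq_nonneg ((a - b) ^ 2 - M ^ 2)]
  · push Not at h
    have hb : M ^ 2 ≤ b ^ 2 := by rw [← sq_abs b]; exact pow_le_pow_left₀ hM h 2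
    have : (a - b) ^ 2 * (1 / 2 * M ^ 2) ≤ (a - b) ^ 2 * (a ^ 2 + a * b + b ^ 2) :=
      mul_le_mul_of_nonneg_left (by nlinarith [sq_nonneg (a + b / 2), sq_nonneg b]) hw
    linarith

theorem aux_integral {u v : ℝ → ℝ} (hv : Continuous v) (hu : Measurable u) {T M W : ℝ}
    (hT : 0 ≤ T) (hM : 0 ≤ M) (hW : 0 ≤ W)
    (hu4 : IntervalIntegrable (fun x => (u x) ^ 4) volume 0 T)
    (hvol : volume (Set.Icc 0 T ∩ {x | |v x| < M}) ≤ ENNReal.ofReal W) :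
    1 / 2 * M ^ 2 * (∫ x in (0:ℝ)..T, (u x - v x) ^ 2) - M ^ 4 / 4 * W ≤
      ∫ x in (0:ℝ)..T, (u x - v x) * ((u x) ^ 3 - (v x) ^ 3) := by
  have hvm := hv.measurable
  have hi2 : IntervalIntegrable (fun x => (u x - v x) ^ 2) volume 0 T := by
    have hc : IntervalIntegrable (fun x => 1 + 2 * v x ^ 2) volume 0 T :=
      Continuous.intervalIntegrable (by fun_prop) _ _
    refine (hu4.add hc).mono_fun' (by fun_prop) (Filter.Eventually.of_forall fun x => ?_)
    simp only [Pi.add_apply]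
    rw [Real.norm_of_nonneg (by positivity)]
    nlinarith [sq_nonneg (u x + v x), sq_nonneg (u x ^ 2 - 1)]
  have hi4 : IntervalIntegrable (fun x => (u x - v x) * ((u x) ^ 3 - (v x) ^ 3)) volume 0 T := by
    have hc : IntervalIntegrable (fun x => 3 * v x ^ 4) volume 0 T :=
      Continuous.intervalIntegrable (by fun_prop) _ _
    refine ((hu4.const_mul 3).add hc).mono_fun' (by fun_prop)
      (Filter.Eventually.of_forall fun x => ?_)
    simp only [Pi.add_apply]
    have e : (u x - v x) * (u x ^ 3 - v x ^ 3) =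
      (u x - v x) ^ 2 * (u x ^ 2 + u x * v x + v x ^ 2) := by ring
    have : 0 ≤ u x ^ 2 + u x * v x + v x ^ 2 := by nlinarith [sq_nonneg (u x + v x), sq_nonneg (u x), sq_nonneg (v x)]
    rw [Real.norm_of_nonneg (by rw [e]; positivity)]
    nlinarith [sq_nonneg (u x ^ 2 + u x * v x), sq_nonneg (v x ^ 2 + u x * v x), sq_nonneg (u x ^ 2 - v x ^ 2), sq_nonneg (u x ^ 2), sq_nonneg (v x ^ 2)]
  have hA : MeasurableSet {x | |v x| < M} := measurableSet_lt (by fun_prop) measurable_const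
  set s : ℝ → ℝ := Set.indicator {x | |v x| < M} (fun _ => M ^ 4 / 4) with hs
  have his : IntervalIntegrable s volume 0 T := by
    rw [intervalIntegrable_iff]
    exact (integrableOn_const (by simp)).indicator hA
  have hint : ∫ x in (0:ℝ)..T, s x ≤ M ^ 4 / 4 * W := by
    rw [intervalIntegral.integral_of_le hT, hs, integral_indicator hA,
      setIntegral_const, smul_eq_mul, mul_comm]
    refine mul_le_mul_of_nonneg_left ?_ (by positivity)
    refine ENNReal.toReal_le_of_le_ofReal hW ?_
    rw [Measure.restrict_apply hA]
    refine (measure_mono ?_).trans hvol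
    rintro x ⟨a, b⟩
    exact ⟨Set.Ioc_subset_Icc_self b, a⟩
  have hmono := intervalIntegral.integral_mono_on hT ((hi2.const_mul (1 / 2 * M ^ 2)).sub his) hi4
    (fun x _ => by
      have := aux_pointwise (u x) (v x) M hM
      simpa [hs, Set.indicator_apply] using this)
  rw [intervalIntegral.integral_sub (hi2.const_mul _) his,
    intervalIntegral.integral_const_mul] at hmono
  linarith

/-- Lemma 9.10: let `g` be a smooth `2π`-periodic function, not identically zero, with
finitely many zeroes in `[0,2π)`, all simple. Then for every `β ∈ [0, γ/4]` there are
`c, C > 0` such that for every `ε ∈ (0,1]`, every `2π`-periodic `C²` stationary solution `v` of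
`ν v'' + η v − v³ + ε^{-γ} g = 0`, and every `2π`-periodic measurable `u` with
`∫₀^{2π} u⁴ < ∞`, one has
`∫₀^{2π} (u−v)(u³−v³) ≥ c ε^{-2β} ∫₀^{2π} (u−v)² − C ε^{(γ−13β)/3}`. -/
theorem stmt15 {ν η γ : ℝ} (hν : 0 < ν) (hη : 0 < η) (hγ : 0 < γ)
    (g : ℝ → ℝ) (hg_smooth : ContDiff ℝ (⊤ : ℕ∞) g)
    (hg_per : Function.Periodic g (2 * Real.pi))
    (hg_ne : ∃ x, g x ≠ 0)
    (hg_fin : {x ∈ Set.Ico 0 (2 * Real.pi) | g x = 0}.Finite)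
    (hg_simple : ∀ x, g x = 0 → deriv g x ≠ 0) :
    ∀ β : ℝ, β ∈ Set.Icc 0 (γ / 4) →
    ∃ c C : ℝ, 0 < c ∧ 0 < C ∧
      ∀ ε ∈ Set.Ioc (0:ℝ) 1,
      ∀ v : ℝ → ℝ, ContDiff ℝ 2 v → Function.Periodic v (2 * Real.pi) →
        (∀ x, ν * iteratedDeriv 2 v x + η * v x - (v x) ^ 3 + ε ^ (-γ) * g x = 0) →
      ∀ u : ℝ → ℝ, Measurable u → Function.Periodic u (2 * Real.pi) →
        IntervalIntegrable (fun x => (u x) ^ 4) volume 0 (2 * Real.pi) →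
        c * ε ^ (-(2 * β)) * (∫ x in (0:ℝ)..(2 * Real.pi), (u x - v x) ^ 2) -
            C * ε ^ ((γ - 13 * β) / 3) ≤
          ∫ x in (0:ℝ)..(2 * Real.pi), (u x - v x) * ((u x) ^ 3 - (v x) ^ 3) := by
  intro β hβ
  let F : Set (ℝ × Set ℝ) := {p | ∃ ε ∈ Set.Ioc (0:ℝ) 1, ∃ v : ℝ → ℝ, ContDiff ℝ 2 v ∧
    (∀ x, ν * iteratedDeriv 2 v x + η * v x - (v x) ^ 3 + ε ^ (-γ) * g x = 0) ∧
    p = (ε ^ ((γ - β) / 3), {x | |v x| < ε ^ (-β)})}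
  have hF : AuxFam g (2 * (1 + η) ^ 2) (2 * (1 + 16 * ν)) F := by
    rintro p ⟨ε, hε, v, hv, hpde, rfl⟩
    refine ⟨Real.rpow_pos_of_pos hε.1 _, fun I hI hg => ?_⟩
    have hd1 : Differentiable ℝ v := hv.differentiable (by norm_num)
    have hd2 : Differentiable ℝ (deriv v) := by
      have : ContDiff ℝ (1 + 1) v := by simpa [one_add_one_eq_two] using hv
      exact (contDiff_succ_iff_deriv.1 this).2.2.differentiable (by norm_num)
    refine aux_eps (v1 := deriv v) (v2 := deriv (deriv v)) (fun x => (hd1 x).hasDerivAt)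
      (fun x => (hd2 x).hasDerivAt) hν hη hβ hε (fun x => ?_) hI hg
    have := hpde x
    rwa [iteratedDeriv_succ, iteratedDeriv_one] at this
  obtain ⟨C0, hC0, H⟩ := aux_global (by positivity) (by positivity) hF
    (hg_smooth.differentiable (by simp)) hg_simple (isCompact_Icc (a := (0:ℝ)) (b := 2 * Real.pi))
  refine ⟨1 / 2, C0 / 4 + 1, by norm_num, by positivity, ?_⟩
  intro ε hε v hv _ hpde u hu _ hu4
  have hε0 := hε.1
  have hvol := H _ ⟨ε, hε, v, hv, hpde, rfl⟩
  have hd0 : 0 < ε ^ ((γ - β) / 3) := Real.rpow_pos_of_pos hε0 _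
  have key := aux_integral hv.continuous hu (by positivity)
    (Real.rpow_pos_of_pos hε0 (-β)).le (mul_nonneg hC0 hd0.le) hu4 hvol
  have e1 : ε ^ (-(2 * β)) = (ε ^ (-β)) ^ 2 := by
    rw [← Real.rpow_natCast, ← Real.rpow_mul hε0.le]
    congr 1; push_cast; ring
  have e2 : ε ^ ((γ - 13 * β) / 3) = (ε ^ (-β)) ^ 4 * ε ^ ((γ - β) / 3) := by
    rw [← Real.rpow_natCast, ← Real.rpow_mul hε0.le, ← Real.rpow_add hε0]
    congr 1; push_cast; ring
  have e3 : 0 < ε ^ ((γ - 13 * β) / 3) := Real.rpow_pos_of_pos hε0 _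
  rw [e1]
  have e4 : (ε ^ (-β)) ^ 4 / 4 * (C0 * ε ^ ((γ - β) / 3)) =
      C0 / 4 * ε ^ ((γ - 13 * β) / 3) := by rw [e2]; ring
  rw [e4] at key
  linarith
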